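/- Let u ∈ W have an Ṡ_n-admissible presentation u = τ_{k_1}^{i_{k_1}}·τ_{k_2}^{i_{k_2}}⋯τ_{k_m}^{i_{k_m}}, let p be an integer with k_m ≤ p ≤ n, and let v = τ_p^{p}. Then the left descent set of u·v satisfies: (i) for every 0 ≤ j < k_m, j ∈ des(u·v) if and only if j ∉ des(u); and (ii) for every k_m ≤ j < p, j ∈ des(u·v). -/

import Mathlib

/-- The Coxeter matrix of type `Bₙ`, with the bond of order `4` between the
generators of indices `0` and `1` (the paper's convention): `s_i² = 1`,
`(s_0·s_1)⁴ = 1`, `(s_i·s_{i+1})³ = 1` for `1 ≤ i ≤ n-2`, and `(s_i·s_j)² = 1`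
for `|i-j| ≥ 2`. -/
def BCoxeterMatrix (n : ℕ) : CoxeterMatrix (Fin n) where
  M := Matrix.of fun i j : Fin n ↦
    if i = j then 1
      else if ((i : ℕ) = 0 ∧ (j : ℕ) = 1) ∨ ((j : ℕ) = 0 ∧ (i : ℕ) = 1) then 4
      else if (j : ℕ) + 1 = i ∨ (i : ℕ) + 1 = j then 3 else 2
  isSymm := by unfold Matrix.IsSymm; aesop
  diagonal := by simp
  off_diagonal := by aesop

variable {n : ℕ} {W : Type*} [Group W]

/-- The simple reflection `s_j` of the Coxeter system, for `0 ≤ j ≤ n-1`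
(junk value `1` for `j ≥ n`). -/
def sgen (cs : CoxeterSystem (BCoxeterMatrix n) W) (j : ℕ) : W :=
  if h : j < n then cs.simple ⟨j, h⟩ else 1

/-- `tau cs k` is the element `τ_k = s_0 · s_1 ⋯ s_{k-1}` (with `τ_0 = 1`). -/
def tau (cs : CoxeterSystem (BCoxeterMatrix n) W) (k : ℕ) : W :=
  ((List.range k).map (sgen cs)).prod

/-- An `Ṡ_n`-admissible presentation of `w ∈ W`: an expression
`w = τ_{k_1}^{i_{k_1}} ⋯ τ_{k_m}^{i_{k_m}}` with `1 ≤ k_1 < ⋯ < k_m ≤ n` and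
nonzero integers `i_{k_j}` such that `-k_j ≤ i_{k_j} ≤ k_j - 1` for all `j`,
`Σ_{j=1}^m i_{k_j} = 0`, and `0 ≤ Σ_{j=r}^m i_{k_j} ≤ k_{r-1}` for all `2 ≤ r ≤ m`. -/
structure IsAdmissible (cs : CoxeterSystem (BCoxeterMatrix n) W) (w : W)
    (m : ℕ) (k : Fin m → ℕ) (i : Fin m → ℤ) : Prop where
  one_le : ∀ j, 1 ≤ k j
  le_n : ∀ j, k j ≤ n
  mono : StrictMono k
  ne_zero : ∀ j, i j ≠ 0
  lb : ∀ j, -(k j : ℤ) ≤ i j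
  ub : ∀ j, i j ≤ (k j : ℤ) - 1
  total : ∑ j, i j = 0
  partialSum : ∀ r : ℕ, 1 ≤ r → ∀ hr : r < m,
    0 ≤ (∑ j ∈ Finset.univ.filter (fun j : Fin m => r ≤ (j : ℕ)), i j) ∧
    (∑ j ∈ Finset.univ.filter (fun j : Fin m => r ≤ (j : ℕ)), i j) ≤
      (k ⟨r - 1, Nat.lt_of_le_of_lt (Nat.sub_le r 1) hr⟩ : ℤ)
  prod_eq : w = ((List.finRange m).map (fun j => tau cs (k j) ^ i j)).prod

/-- `j ∈ des(w)`: the index `j` (with `0 ≤ j ≤ n-1`) is a left descent of `w`,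
i.e. `ℓ(s_j · w) < ℓ(w)`. -/
def IsDescentAt (cs : CoxeterSystem (BCoxeterMatrix n) W) (w : W) (j : ℕ) : Prop :=
  ∃ h : j < n, cs.IsLeftDescent w ⟨j, h⟩

namespace CoxeterSystem

variable {B : Type*} {M : CoxeterMatrix B} (cs : CoxeterSystem M W)

open Classical in
/-- The action of the simple reflection `s_i` on `W × ZMod 2`: conjugation by `s_i` on the first
component, and a flip of the second component exactly at `s_i`. -/
noncomputable def flip (i : B) : Function.End (W × ZMod 2) := fun x ↦
  (cs.simple i * x.1 * cs.simple i, x.2 + if x.1 = cs.simple i then 1 else 0)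

open Classical in
theorem flip_mul_flip_pow_apply (i j : B) (r : ℕ) (x : W × ZMod 2) :
    ((cs.flip i * cs.flip j) ^ r : Function.End (W × ZMod 2)) x =
      ((cs.simple i * cs.simple j) ^ r * x.1 * ((cs.simple i * cs.simple j) ^ r)⁻¹,
        x.2 + ∑ k ∈ Finset.range (2 * r),
          if x.1 = cs.simple j * (cs.simple i * cs.simple j) ^ k then 1 else 0) := by
  induction r with
  | zero => simp; rfl
  | succ r ih =>
    have hconj : ∀ k : ℕ, cs.simple j * (cs.simple i * cs.simple j) ^ k =
        ((cs.simple i * cs.simple j) ^ k)⁻¹ * cs.simple j := by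
      intro k
      have hs : SemiconjBy (cs.simple j) (cs.simple i * cs.simple j)
          (cs.simple i * cs.simple j)⁻¹ := by
        simp [SemiconjBy, mul_assoc]
      have := (hs.pow_right k).eq
      rwa [inv_pow] at this
    have h0 : (cs.simple i * cs.simple j) ^ r * x.1 * ((cs.simple i * cs.simple j) ^ r)⁻¹ =
        cs.simple j ↔ x.1 = cs.simple j * (cs.simple i * cs.simple j) ^ (2 * r) := by
      rw [two_mul, pow_add, ← mul_assoc, hconj]
      generalize (cs.simple i * cs.simple j) ^ r = g
      rw [mul_inv_eq_iff_eq_mul, mul_assoc, eq_inv_mul_iff_mul_eq]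
    have h1 : cs.simple j * ((cs.simple i * cs.simple j) ^ r * x.1 *
          ((cs.simple i * cs.simple j) ^ r)⁻¹) * cs.simple j = cs.simple i ↔
        x.1 = cs.simple j * (cs.simple i * cs.simple j) ^ (2 * r + 1) := by
      have e : cs.simple j * (cs.simple i * cs.simple j) ^ (2 * r + 1) =
          ((cs.simple i * cs.simple j) ^ r)⁻¹ * (cs.simple j * cs.simple i * cs.simple j) *
            (cs.simple i * cs.simple j) ^ r := by
        rw [show 2 * r + 1 = r + (1 + r) by ring, pow_add, ← mul_assoc, hconj, pow_add]
        simp [mul_assoc]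
      rw [e]
      generalize (cs.simple i * cs.simple j) ^ r = g
      constructor
      · intro h
        rw [← h]
        simp [mul_assoc]
      · intro h
        rw [h]
        simp [mul_assoc]
    rw [pow_succ']
    change cs.flip i (cs.flip j (((cs.flip i * cs.flip j) ^ r : Function.End (W × ZMod 2)) x)) = _
    rw [ih]
    simp only [flip, Prod.mk.injEq]
    refine ⟨by rw [pow_succ']; simp [mul_assoc], ?_⟩
    rw [show 2 * (r + 1) = 2 * r + 1 + 1 by ring, Finset.sum_range_succ, Finset.sum_range_succ]
    simp only [h0, h1, add_assoc]

open Classical in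
theorem flip_mul_flip_pow_eq_one {i j : B} {m : ℕ}
    (h : (cs.simple i * cs.simple j) ^ m = 1) :
    (cs.flip i * cs.flip j : Function.End (W × ZMod 2)) ^ m = 1 := by
  funext x
  rw [flip_mul_flip_pow_apply, two_mul, Finset.sum_range_add]
  simp only [pow_add, h, one_mul, CharTwo.add_self_eq_zero, inv_one, mul_one, add_zero]
  rfl

theorem isLiftable_flip : M.IsLiftable cs.flip := fun i j ↦
  cs.flip_mul_flip_pow_eq_one (cs.simple_mul_simple_pow i j)

/-- The action of `W` on `W × ZMod 2` extending `CoxeterSystem.flip`. -/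
noncomputable def flipHom : W →* Function.End (W × ZMod 2) :=
  cs.lift ⟨cs.flip, cs.isLiftable_flip⟩

/-- The parity of the number of occurrences of `t` in the right inversion sequence of a word
for `w`. -/
noncomputable def inversionParity (w t : W) : ZMod 2 := (cs.flipHom w (t, 0)).2

theorem flipHom_simple (i : B) : cs.flipHom (cs.simple i) = cs.flip i :=
  cs.lift_apply_simple cs.isLiftable_flip i

theorem flipHom_mul_apply (v w : W) (x : W × ZMod 2) :
    cs.flipHom (v * w) x = cs.flipHom v (cs.flipHom w x) := by
  rw [map_mul]; rfl

theorem flipHom_apply (w : W) (x : W × ZMod 2) :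
    cs.flipHom w x = (w * x.1 * w⁻¹, x.2 + cs.inversionParity w x.1) := by
  induction w using cs.simple_induction_left generalizing x with
  | one =>
    simp only [inversionParity, map_one]
    change x = (1 * x.1 * 1⁻¹, x.2 + 0)
    simp
  | mul_simple_left w i ih =>
    simp only [inversionParity, flipHom_mul_apply]
    rw [ih x, ih (x.1, 0)]
    simp [flipHom_simple, flip, mul_assoc, add_assoc]

theorem inversionParity_mul (v w t : W) :
    cs.inversionParity (v * w) t =
      cs.inversionParity w t + cs.inversionParity v (w * t * w⁻¹) := by
  rw [inversionParity, flipHom_mul_apply, flipHom_apply, flipHom_apply]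
  simp

open Classical in
theorem inversionParity_simple (i : B) (t : W) :
    cs.inversionParity (cs.simple i) t = if t = cs.simple i then 1 else 0 := by
  simp [inversionParity, flipHom_simple, flip]

theorem inversionParity_one (t : W) : cs.inversionParity 1 t = 0 := by
  rw [inversionParity, map_one]; rfl

theorem mem_rightInvSeq_of_inversionParity_ne_zero (ω : List B) (t : W)
    (h : cs.inversionParity (cs.wordProd ω) t ≠ 0) : t ∈ cs.rightInvSeq ω := by
  induction ω with
  | nil => simp [inversionParity_one] at h
  | cons i ω ih =>
    rw [rightInvSeq, List.mem_cons]
    by_contra! hc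
    apply h
    rw [wordProd_cons, inversionParity_mul, inversionParity_simple, if_neg, add_zero]
    · by_contra h0
      exact hc.2 (ih h0)
    · intro he
      apply hc.1
      rw [← he]; group

theorem isRightDescent_iff_inversionParity (w : W) (i : B) :
    cs.IsRightDescent w i ↔ cs.inversionParity w (cs.simple i) = 1 := by
  have key : ∀ x : W, cs.inversionParity x (cs.simple i) ≠ 0 → cs.IsRightDescent x i := by
    intro x hx
    obtain ⟨ω, hω, rfl⟩ := cs.exists_isReduced x
    exact (cs.isRightInversion_of_mem_rightInvSeq hω
      (cs.mem_rightInvSeq_of_inversionParity_ne_zero ω _ hx)).2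
  refine ⟨fun h ↦ ?_, fun h ↦ key w (by rw [h]; decide)⟩
  by_contra h1
  have h0 : cs.inversionParity w (cs.simple i) = 0 := by
    revert h1; generalize cs.inversionParity w (cs.simple i) = a; revert a; decide
  refine cs.isRightDescent_iff_not_isRightDescent_mul.mp h (key _ ?_)
  rw [inversionParity_mul, inversionParity_simple]
  simp [h0]

theorem isLeftDescent_iff_inversionParity (w : W) (i : B) :
    cs.IsLeftDescent w i ↔ cs.inversionParity w⁻¹ (cs.simple i) = 1 := by
  rw [← isRightDescent_iff_inversionParity, cs.isRightDescent_inv_iff]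

theorem mem_closure_of_inversionParity_ne_zero {I : Set B} {w t : W}
    (hw : w ∈ Subgroup.closure (cs.simple '' I)) (h : cs.inversionParity w t ≠ 0) :
    t ∈ Subgroup.closure (cs.simple '' I) := by
  induction hw using Subgroup.closure_induction generalizing t with
  | mem x hx =>
    obtain ⟨i, hi, rfl⟩ := hx
    rw [inversionParity_simple] at h
    have : t = cs.simple i := by by_contra hc; simp [hc] at h
    rw [this]
    exact Subgroup.subset_closure ⟨i, hi, rfl⟩
  | one => simp [inversionParity_one] at h
  | mul x y hx hy ihx ihy =>
    rw [inversionParity_mul] at h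
    by_cases h0 : cs.inversionParity y t = 0
    · have := ihx (t := y * t * y⁻¹) (by simpa [h0] using h)
      simpa [mul_assoc] using mul_mem (mul_mem (inv_mem hy) this) hy
    · exact ihy h0
  | inv x hx ih =>
    have e := cs.inversionParity_mul x x⁻¹ t
    rw [mul_inv_cancel, inversionParity_one] at e
    have := ih (t := x⁻¹ * t * x⁻¹⁻¹) (fun h0 ↦ h (by rw [h0, add_zero] at e; exact e.symm))
    simpa [mul_assoc] using mul_mem (mul_mem hx this) (inv_mem hx)

/-- If `v` centralizes `w` and `t`, its inversion parities at `t` and its conjugate by `w` agree. -/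
theorem inversionParity_conj {v w t : W} (hw : Commute v w) (ht : Commute v t) :
    cs.inversionParity v (w * t * w⁻¹) = cs.inversionParity v t := by
  have h := cs.inversionParity_mul v w t
  rw [hw.eq, inversionParity_mul, ht.eq, mul_inv_cancel_right, add_comm] at h
  exact (add_left_cancel h).symm

end CoxeterSystem

section Braid

variable {G : Type*} [Group G]

/-- The relations of type `B_p` among the first `p` terms of a sequence of group elements. -/
structure IsBraidB (s : ℕ → G) (p : ℕ) : Prop where
  sq : ∀ i < p, s i * s i = 1
  four : 1 < p → s 0 * s 1 * s 0 * s 1 = s 1 * s 0 * s 1 * s 0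
  three : ∀ i, 1 ≤ i → i + 1 < p → s i * s (i + 1) * s i = s (i + 1) * s i * s (i + 1)
  comm : ∀ i j, i + 2 ≤ j → j < p → Commute (s i) (s j)

/-- The product `s 0 * s 1 * ⋯ * s (k - 1)`. -/
def rangeProd (s : ℕ → G) (k : ℕ) : G := ((List.range k).map s).prod

theorem rangeProd_zero (s : ℕ → G) : rangeProd s 0 = 1 := by simp [rangeProd]

theorem rangeProd_succ (s : ℕ → G) (k : ℕ) : rangeProd s (k + 1) = rangeProd s k * s k := by
  simp [rangeProd, List.range_succ]

namespace IsBraidB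

variable {s : ℕ → G} {p : ℕ}

theorem mono (h : IsBraidB s p) {q : ℕ} (hq : q ≤ p) : IsBraidB s q where
  sq i hi := h.sq i (by omega)
  four hq := h.four (by omega)
  three i hi hi' := h.three i hi (by omega)
  comm i j hij hj := h.comm i j hij (by omega)

theorem commute_rangeProd (h : IsBraidB s p) {k j : ℕ} (hkj : k < j) (hj : j < p) :
    Commute (rangeProd s k) (s j) := by
  induction k with
  | zero => simp [rangeProd_zero]
  | succ k ih =>
    rw [rangeProd_succ]
    exact (ih (by omega)).mul_left (h.comm _ _ (by omega) hj)

theorem rangeProd_semiconj (h : IsBraidB s p) {k i : ℕ} (hi : 1 ≤ i) (hik : i + 2 ≤ k)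
    (hk : k ≤ p) : SemiconjBy (rangeProd s k) (s i) (s (i + 1)) := by
  induction k, hik using Nat.le_induction with
  | base =>
    have hc := (h.commute_rangeProd (Nat.lt_succ_self i) (by omega)).eq
    have h3 := h.three i hi (by omega)
    simp only [SemiconjBy, rangeProd_succ]
    simp only [mul_assoc] at h3 ⊢
    rw [h3, ← mul_assoc, hc, mul_assoc]
  | succ k hik ih =>
    rw [rangeProd_succ]
    exact SemiconjBy.mul_left (ih (by omega)) (h.comm i k hik (by omega)).symm

theorem rangeProd_mul_rangeProd (h : IsBraidB s (p + 2)) :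
    rangeProd s (p + 2) * rangeProd s (p + 1) =
      s 1 * (rangeProd s (p + 2) * rangeProd s (p + 2)) := by
  induction p with
  | zero =>
    have h4 := h.four (by omega)
    have h0 := h.sq 0 (by omega)
    have h1 := h.sq 1 (by omega)
    simp only [rangeProd_succ, rangeProd_zero, one_mul, zero_add]
    calc s 0 * s 1 * s 0 = (s 0 * s 1 * s 0 * s 1) * s 1 := by simp [mul_assoc, h1]
      _ = s 1 * (s 0 * s 1 * (s 0 * s 1)) := by rw [h4]; simp only [mul_assoc]
  | succ p ih =>
    have ih := ih (h.mono (by omega))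
    have hc := (h.commute_rangeProd (k := p + 1) (j := p + 2) (by omega) (by omega)).eq
    have h3 := h.three (p + 1) (by omega) (by omega)
    calc rangeProd s (p + 3) * rangeProd s (p + 2)
        = rangeProd s (p + 2) * (s (p + 2) * rangeProd s (p + 1)) * s (p + 1) := by
          rw [rangeProd_succ s (p + 2), rangeProd_succ s (p + 1)]; simp only [mul_assoc]
      _ = rangeProd s (p + 2) * rangeProd s (p + 1) * (s (p + 2) * s (p + 1)) := by
          rw [← hc]; simp only [mul_assoc]
      _ = s 1 * (rangeProd s (p + 2) * (rangeProd s (p + 1) * s (p + 1))) *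
            (s (p + 2) * s (p + 1)) := by
          rw [ih, ← rangeProd_succ s (p + 1)]
      _ = s 1 * rangeProd s (p + 2) * rangeProd s (p + 1) *
            (s (p + 1) * s (p + 2) * s (p + 1)) := by simp only [mul_assoc]
      _ = s 1 * rangeProd s (p + 2) * (rangeProd s (p + 1) * s (p + 2)) *
            (s (p + 1) * s (p + 2)) := by rw [h3]; simp only [mul_assoc]
      _ = s 1 * (rangeProd s (p + 3) * rangeProd s (p + 3)) := by
          rw [hc, rangeProd_succ s (p + 2), rangeProd_succ s (p + 1)]; simp only [mul_assoc]

theorem rangeProd_pow_semiconj (h : IsBraidB s p) {i a : ℕ} (hi : 1 ≤ i) (hia : i + a < p) :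
    SemiconjBy (rangeProd s p ^ a) (s i) (s (i + a)) := by
  induction a with
  | zero => simp
  | succ a ih =>
    rw [pow_succ']
    exact SemiconjBy.mul_left
      (h.rangeProd_semiconj (i := i + a) (by omega) (by omega) le_rfl) (ih (by omega))

theorem rangeProd_pow_commute_of_pos (h : IsBraidB s p) {i : ℕ} (hi : 1 ≤ i) (hip : i < p) :
    Commute (rangeProd s p ^ p) (s i) := by
  have h2 : SemiconjBy (rangeProd s p ^ 2) (s (p - 1)) (s 1) := by
    obtain ⟨q, rfl⟩ : ∃ q, p = q + 2 := ⟨p - 2, by omega⟩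
    have e := h.rangeProd_mul_rangeProd
    rw [SemiconjBy, pow_two, ← e, show q + 2 - 1 = q + 1 by omega, mul_assoc]
    congr 1
    rw [rangeProd_succ s (q + 1), mul_assoc, h.sq _ (by omega), mul_one]
  have ha : SemiconjBy (rangeProd s p ^ (p - 1 - i)) (s i) (s (p - 1)) := by
    simpa [show i + (p - 1 - i) = p - 1 by omega] using
      h.rangeProd_pow_semiconj (a := p - 1 - i) hi (by omega)
  have hb : SemiconjBy (rangeProd s p ^ (i - 1)) (s 1) (s i) := by
    simpa [show 1 + (i - 1) = i by omega] using
      h.rangeProd_pow_semiconj (i := 1) (a := i - 1) le_rfl (by omega)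
  have := (hb.mul_left h2).mul_left ha
  rwa [← pow_add, ← pow_add, show i - 1 + 2 + (p - 1 - i) = p by omega] at this

theorem rangeProd_pow_commute_rangeProd (h : IsBraidB s p) {k : ℕ} (hk : 1 ≤ k) (hkp : k ≤ p) :
    Commute (rangeProd s p ^ p) (rangeProd s k) := by
  induction hkp using Nat.decreasingInduction with
  | self => exact (Commute.refl _).pow_left p
  | of_succ k hkp ih =>
    have h1 := (ih (by omega)).mul_right (h.rangeProd_pow_commute_of_pos hk hkp)
    rwa [rangeProd_succ, mul_assoc, h.sq k hkp, mul_one] at h1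

theorem rangeProd_pow_commute (h : IsBraidB s p) {i : ℕ} (hip : i < p) :
    Commute (rangeProd s p ^ p) (s i) := by
  rcases Nat.eq_zero_or_pos i with rfl | hi
  · simpa [rangeProd_succ, rangeProd_zero] using
      h.rangeProd_pow_commute_rangeProd (k := 1) le_rfl hip
  · exact h.rangeProd_pow_commute_of_pos hi hip

end IsBraidB

end Braid

theorem tau_eq_rangeProd (cs : CoxeterSystem (BCoxeterMatrix n) W) (k : ℕ) :
    tau cs k = rangeProd (sgen cs) k := rfl

theorem sgen_of_lt (cs : CoxeterSystem (BCoxeterMatrix n) W) {j : ℕ} (hj : j < n) :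
    sgen cs j = cs.simple ⟨j, hj⟩ := dif_pos hj

theorem isBraidB_sgen (cs : CoxeterSystem (BCoxeterMatrix n) W) : IsBraidB (sgen cs) n := by
  have inv_eq : ∀ i (hi : i < n), (sgen cs i)⁻¹ = sgen cs i := by
    intro i hi
    simp [sgen_of_lt cs hi]
  refine ⟨fun i hi ↦ by simp [sgen_of_lt cs hi], fun hn ↦ ?_, fun i hi hi' ↦ ?_,
    fun i j hij hj ↦ ?_⟩
  · have h := cs.simple_mul_simple_pow ⟨0, by omega⟩ ⟨1, hn⟩
    rw [← sgen_of_lt, ← sgen_of_lt] at h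
    simp only [BCoxeterMatrix, Matrix.of_apply] at h
    norm_num [pow_succ] at h
    have h' := eq_inv_of_mul_eq_one_left (a := sgen cs 0 * sgen cs 1 * sgen cs 0 * sgen cs 1)
      (b := sgen cs 0 * sgen cs 1 * sgen cs 0 * sgen cs 1) (by simpa [mul_assoc] using h)
    rw [h']
    simp [inv_eq 0 (by omega), inv_eq 1 hn, mul_assoc]
  · have h := cs.simple_mul_simple_pow ⟨i, by omega⟩ ⟨i + 1, hi'⟩
    rw [← sgen_of_lt, ← sgen_of_lt] at h
    have e : (BCoxeterMatrix n).M ⟨i, by omega⟩ ⟨i + 1, hi'⟩ = 3 := by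
      simp [BCoxeterMatrix]; omega
    rw [e] at h
    have h' := eq_inv_of_mul_eq_one_left (a := sgen cs i * sgen cs (i + 1) * sgen cs i)
      (b := sgen cs (i + 1) * sgen cs i * sgen cs (i + 1)) (by
        simpa [pow_succ, mul_assoc] using h)
    rw [h']
    simp [inv_eq i (by omega), inv_eq _ hi', mul_assoc]
  · have h := cs.simple_mul_simple_pow ⟨i, by omega⟩ ⟨j, hj⟩
    rw [← sgen_of_lt, ← sgen_of_lt] at h
    have e : (BCoxeterMatrix n).M ⟨i, by omega⟩ ⟨j, hj⟩ = 2 := by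
      simp [BCoxeterMatrix]
      rw [if_neg (by omega), if_neg (by omega), if_neg (by omega)]
    rw [e] at h
    have h' := eq_inv_of_mul_eq_one_left (a := sgen cs i * sgen cs j)
      (b := sgen cs i * sgen cs j) (by simpa [pow_succ, mul_assoc] using h)
    rw [Commute, SemiconjBy, h']
    simp [inv_eq i (by omega), inv_eq j hj]

/-- The action of `s_j` on the integers by signed permutations: `s_0` exchanges `1` and `-1`, and
`s_j` with `1 ≤ j` exchanges `j` with `j + 1` and `-j` with `-(j + 1)`. -/
def signedSwap (j : ℕ) : Function.End ℤ := fun x ↦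
  if j = 0 then (if x = 1 then -1 else if x = -1 then 1 else x)
  else if x = j then j + 1 else if x = j + 1 then j
  else if x = -j then -(j + 1) else if x = -(j + 1) then -j else x

theorem signedSwap_neg (j : ℕ) (x : ℤ) : signedSwap j (-x) = -signedSwap j x := by
  unfold signedSwap
  split_ifs <;> omega

theorem signedSwap_signedSwap (j : ℕ) (x : ℤ) : signedSwap j (signedSwap j x) = x := by
  unfold signedSwap
  grind

theorem signedSwap_eq_self_of_ne {i j : ℕ} (hij : i + 2 ≤ j ∨ j + 2 ≤ i) {x : ℤ}
    (hx : signedSwap j x ≠ x) : signedSwap i x = x := by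
  unfold signedSwap at *
  grind

theorem signedSwap_comm {i j : ℕ} (hij : i + 2 ≤ j ∨ j + 2 ≤ i) (x : ℤ) :
    signedSwap i (signedSwap j x) = signedSwap j (signedSwap i x) := by
  have moved {k : ℕ} {y : ℤ} (hy : signedSwap k y ≠ y) :
      signedSwap k (signedSwap k y) ≠ signedSwap k y := by
    rw [signedSwap_signedSwap]
    exact hy.symm
  by_cases hj : signedSwap j x = x
  · by_cases hi : signedSwap i x = x
    · rw [hi, hj, hi]
    · rw [hj, signedSwap_eq_self_of_ne hij.symm (moved hi)]
  · rw [signedSwap_eq_self_of_ne hij hj, signedSwap_eq_self_of_ne hij (moved hj)]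

theorem isLiftable_signedSwap :
    (BCoxeterMatrix n).IsLiftable fun i : Fin n ↦ signedSwap (i : ℕ) := by
  have four : (signedSwap 0 * signedSwap 1) ^ 4 = 1 := by
    funext x
    change signedSwap 0 (signedSwap 1 (signedSwap 0 (signedSwap 1 (signedSwap 0 (signedSwap 1
      (signedSwap 0 (signedSwap 1 x))))))) = x
    by_cases h : -2 ≤ x ∧ x ≤ 2
    · obtain ⟨h1, h2⟩ := h
      interval_cases x <;> simp [signedSwap]
    · have h0 : signedSwap 0 x = x := by unfold signedSwap; grind
      have h1 : signedSwap 1 x = x := by unfold signedSwap; grind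
      simp only [h0, h1]
  have four' : (signedSwap 1 * signedSwap 0) ^ 4 = 1 := by
    funext x
    change signedSwap 1 (signedSwap 0 (signedSwap 1 (signedSwap 0 (signedSwap 1 (signedSwap 0
      (signedSwap 1 (signedSwap 0 x))))))) = x
    by_cases h : -2 ≤ x ∧ x ≤ 2
    · obtain ⟨h1, h2⟩ := h
      interval_cases x <;> simp [signedSwap]
    · have h0 : signedSwap 0 x = x := by unfold signedSwap; grind
      have h1 : signedSwap 1 x = x := by unfold signedSwap; grind
      simp only [h0, h1]
  have three : ∀ i, 1 ≤ i → ((signedSwap i * signedSwap (i + 1)) ^ 3 = 1 ∧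
      (signedSwap (i + 1) * signedSwap i) ^ 3 = 1) := by
    intro i hi
    have a0 : signedSwap i (i : ℤ) = i + 1 := by unfold signedSwap; grind
    have a1 : signedSwap i (i + 1 : ℤ) = i := by unfold signedSwap; grind
    have a2 : signedSwap i (i + 2 : ℤ) = i + 2 := by unfold signedSwap; grind
    have b0 : signedSwap (i + 1) (i : ℤ) = i := by unfold signedSwap; grind
    have b1 : signedSwap (i + 1) (i + 1 : ℤ) = i + 2 := by unfold signedSwap; grind
    have b2 : signedSwap (i + 1) (i + 2 : ℤ) = i + 1 := by unfold signedSwap; grind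
    suffices H : ∀ x : ℤ,
        signedSwap i (signedSwap (i + 1) (signedSwap i (signedSwap (i + 1)
          (signedSwap i (signedSwap (i + 1) x))))) = x ∧
        signedSwap (i + 1) (signedSwap i (signedSwap (i + 1) (signedSwap i
          (signedSwap (i + 1) (signedSwap i x))))) = x from
      ⟨funext fun x ↦ (H x).1, funext fun x ↦ (H x).2⟩
    intro x
    by_cases hx : x = i ∨ x = i + 1 ∨ x = i + 2 ∨ x = -i ∨ x = -(i + 1) ∨ x = -(i + 2)
    · rcases hx with rfl | rfl | rfl | rfl | rfl | rfl <;>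
        simp only [signedSwap_neg, a0, a1, a2, b0, b1, b2, and_self]
    · have h0 : signedSwap i x = x := by unfold signedSwap; grind
      have h1 : signedSwap (i + 1) x = x := by unfold signedSwap; grind
      simp only [h0, h1, and_self]
  rintro ⟨i, hi⟩ ⟨j, hj⟩
  have e : (BCoxeterMatrix n).M ⟨i, hi⟩ ⟨j, hj⟩ = if i = j then 1
      else if (i = 0 ∧ j = 1) ∨ (j = 0 ∧ i = 1) then 4
      else if j + 1 = i ∨ i + 1 = j then 3 else 2 := by
    simp [BCoxeterMatrix]
  change (signedSwap i * signedSwap j) ^ ((BCoxeterMatrix n).M ⟨i, hi⟩ ⟨j, hj⟩) = 1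
  rw [e]
  split_ifs with h1 h2 h3
  · subst h1
    rw [pow_one]
    funext x
    exact signedSwap_signedSwap i x
  · rcases h2 with ⟨rfl, rfl⟩ | ⟨rfl, rfl⟩
    · exact four
    · exact four'
  · rcases h3 with rfl | rfl
    · exact (three j (by omega)).2
    · exact (three i (by omega)).1
  · funext x
    change signedSwap i (signedSwap j (signedSwap i (signedSwap j x))) = x
    rw [signedSwap_comm (by omega), signedSwap_signedSwap, signedSwap_signedSwap]

/-- The action of a Coxeter group of type `B_n` on the integers by signed permutations. -/
noncomputable def signedAction (cs : CoxeterSystem (BCoxeterMatrix n) W) :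
    W →* Function.End ℤ :=
  cs.lift ⟨fun i : Fin n ↦ signedSwap (i : ℕ), isLiftable_signedSwap⟩

section SignedAction

variable (cs : CoxeterSystem (BCoxeterMatrix n) W)

theorem signedAction_simple (i : Fin n) : signedAction cs (cs.simple i) = signedSwap i :=
  cs.lift_apply_simple isLiftable_signedSwap i

theorem signedAction_sgen {j : ℕ} (hj : j < n) : signedAction cs (sgen cs j) = signedSwap j := by
  rw [sgen_of_lt cs hj, signedAction_simple]

theorem signedAction_mul_apply (v w : W) (x : ℤ) :
    signedAction cs (v * w) x = signedAction cs v (signedAction cs w x) := by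
  rw [map_mul]
  rfl

theorem signedAction_one_apply (x : ℤ) : signedAction cs 1 x = x := by
  rw [map_one]
  rfl

theorem signedAction_neg (w : W) (x : ℤ) : signedAction cs w (-x) = -signedAction cs w x := by
  induction w using cs.simple_induction_left with
  | one => simp only [signedAction_one_apply]
  | mul_simple_left w i ih =>
    rw [signedAction_mul_apply, signedAction_mul_apply, ih, signedAction_simple, signedSwap_neg]

theorem signedAction_tau {k : ℕ} (hk : k ≤ n) {x : ℤ} (hx : 1 ≤ x) :
    signedAction cs (tau cs k) x = if x < k then x + 1 else if x = k then -1 else x := by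
  rw [tau_eq_rangeProd]
  induction k generalizing x with
  | zero =>
    rw [rangeProd_zero, signedAction_one_apply]
    grind
  | succ k ih =>
    rw [rangeProd_succ, signedAction_mul_apply, signedAction_sgen cs (by omega)]
    rcases Nat.eq_zero_or_pos k with rfl | hk0
    · rw [rangeProd_zero, signedAction_one_apply]
      unfold signedSwap
      grind
    · rw [ih (by omega) (by unfold signedSwap; grind)]
      unfold signedSwap
      grind

theorem signedAction_tau_pow {p : ℕ} (hp : p ≤ n) {r : ℕ} (hr : r ≤ p) {x : ℤ} (hx : 1 ≤ x)
    (hxp : x ≤ p) :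
    signedAction cs (tau cs p ^ r) x = if x + r ≤ p then x + r else -(x + r - p) := by
  induction r with
  | zero =>
    rw [pow_zero, signedAction_one_apply]
    grind
  | succ r ih =>
    rw [pow_succ', signedAction_mul_apply, ih (by omega)]
    split_ifs with h1 h2 h2
    · rw [signedAction_tau cs hp (by omega)]
      grind
    · rw [signedAction_tau cs hp (by omega)]
      grind
    · grind
    · rw [signedAction_neg, signedAction_tau cs hp (by omega)]
      grind

theorem signedAction_tau_pow_self {p : ℕ} (hp : p ≤ n) {x : ℤ} (hx : -p ≤ x) (hxp : x ≤ p) :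
    signedAction cs (tau cs p ^ p) x = -x := by
  have pos {y : ℤ} (hy : 1 ≤ y) (hyp : y ≤ p) : signedAction cs (tau cs p ^ p) y = -y := by
    rw [signedAction_tau_pow cs hp le_rfl hy hyp]
    grind
  rcases lt_trichotomy x 0 with h | rfl | h
  · obtain ⟨y, rfl⟩ : ∃ y, x = -y := ⟨-x, by simp⟩
    rw [signedAction_neg, pos (by omega) (by omega)]
  · have := signedAction_neg cs (tau cs p ^ p) 0
    simp only [neg_zero] at this ⊢
    omega
  · exact pos (by omega) hxp

/-- The pairs `a < b` of integers in `[-n, n]` with `a ≠ 0` whose order is reversed by a signed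
permutation; each inversion of the signed permutation accounts for two of them. -/
noncomputable def signedInversions (w : W) : Finset (ℤ × ℤ) :=
  (Finset.Icc (-n : ℤ) n ×ˢ Finset.Icc (-n : ℤ) n).filter fun x ↦
    x.1 ≠ 0 ∧ x.1 < x.2 ∧ signedAction cs w x.2 < signedAction cs w x.1

theorem card_signedInversions_mul_simple_le (w : W) (i : Fin n) :
    (signedInversions cs (w * cs.simple i)).card ≤ (signedInversions cs w).card + 2 := by
  obtain ⟨j, hj⟩ := i
  let E : Finset (ℤ × ℤ) :=
    if j = 0 then {(-1, 0), (-1, 1)} else {((j : ℤ), (j : ℤ) + 1), (-((j : ℤ) + 1), -(j : ℤ))}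
  have hE : E.card ≤ 2 := by
    unfold E
    split_ifs <;> exact Finset.card_le_two
  refine le_trans (Finset.card_le_card (t := (signedInversions cs w).image
    (fun x ↦ (signedSwap j x.1, signedSwap j x.2)) ∪ E) ?_)
    ((Finset.card_union_le _ _).trans (add_le_add Finset.card_image_le hE))
  rintro ⟨a, b⟩ hab
  simp only [signedInversions, Finset.mem_filter, Finset.mem_product, Finset.mem_Icc,
    signedAction_mul_apply, signedAction_simple] at hab
  obtain ⟨⟨ha, hb⟩, ha0, hlt, hinv⟩ := hab
  have box {y : ℤ} (hy : -(n : ℤ) ≤ y ∧ y ≤ n) :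
      -(n : ℤ) ≤ signedSwap j y ∧ signedSwap j y ≤ n := by
    unfold signedSwap
    grind
  rw [Finset.mem_union]
  rcases lt_trichotomy (signedSwap j a) (signedSwap j b) with h | h | h
  · refine Or.inl (Finset.mem_image.2 ⟨(signedSwap j a, signedSwap j b), ?_, ?_⟩)
    · simp only [signedInversions, Finset.mem_filter, Finset.mem_product, Finset.mem_Icc]
      refine ⟨⟨box ha, box hb⟩, ?_, h, hinv⟩
      unfold signedSwap
      grind
    · simp only [signedSwap_signedSwap]
  · rw [h] at hinv
    exact absurd hinv (lt_irrefl _)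
  · right
    unfold E
    unfold signedSwap at h
    split_ifs with hj0 <;> simp only [Finset.mem_insert, Finset.mem_singleton, Prod.mk.injEq] <;>
      grind

theorem card_signedInversions_le (w : W) :
    (signedInversions cs w).card ≤ 2 * cs.length w := by
  obtain ⟨ω, hω, rfl⟩ := cs.exists_isReduced w
  rw [hω]
  clear hω
  induction ω using List.reverseRecOn with
  | nil =>
    simp only [CoxeterSystem.wordProd_nil, List.length_nil, mul_zero, nonpos_iff_eq_zero,
      Finset.card_eq_zero, signedInversions, signedAction_one_apply]
    refine Finset.filter_eq_empty_iff.2 fun x _ h ↦ ?_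
    omega
  | append_singleton ω i ih =>
    rw [cs.wordProd_append, cs.wordProd_singleton, List.length_append, List.length_singleton]
    have := card_signedInversions_mul_simple_le cs (cs.wordProd ω) i
    omega

theorem sq_le_length_tau_pow_self {p : ℕ} (hp : p ≤ n) : p * p ≤ cs.length (tau cs p ^ p) := by
  have h : (Finset.Icc (1 : ℤ) p ×ˢ Finset.Ico (0 : ℤ) (2 * p)).card ≤
      (signedInversions cs (tau cs p ^ p)).card := by
    refine Finset.card_le_card_of_injOn
      (fun x ↦ if x.2 < p - x.1 then (x.1, x.1 + 1 + x.2) else (-x.1, x.2 - p + 1)) ?_ ?_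
    · rintro ⟨x, y⟩ hxy
      simp only [Finset.coe_product, Set.mem_prod, Finset.mem_coe, Finset.mem_Icc,
        Finset.mem_Ico] at hxy
      have key {a b : ℤ} (ha : -p ≤ a) (ha0 : a ≠ 0) (hab : a < b) (hb : b ≤ p) :
          (a, b) ∈ signedInversions cs (tau cs p ^ p) := by
        simp only [signedInversions, Finset.mem_filter, Finset.mem_product, Finset.mem_Icc]
        rw [signedAction_tau_pow_self cs hp ha (by omega),
          signedAction_tau_pow_self cs hp (by omega) hb]
        omega
      rw [Finset.mem_coe]
      dsimp only
      split_ifs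
      · exact key (by omega) (by omega) (by omega) (by omega)
      · exact key (by omega) (by omega) (by omega) (by omega)
    · rintro ⟨x, y⟩ hxy ⟨x', y'⟩ hxy' he
      simp only [Finset.coe_product, Set.mem_prod, Finset.mem_coe, Finset.mem_Icc,
        Finset.mem_Ico] at hxy hxy'
      dsimp only at he
      split_ifs at he <;> simp only [Prod.mk.injEq] at he ⊢ <;> omega
  have hc := card_signedInversions_le cs (tau cs p ^ p)
  simp only [Finset.card_product, Int.card_Icc, Int.card_Ico] at h
  have e1 : ((p : ℤ) + 1 - 1).toNat = p := by omega
  have e2 : (2 * (p : ℤ) - 0).toNat = 2 * p := by omega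
  rw [e1, e2] at h
  nlinarith

end SignedAction

section Descents

variable (cs : CoxeterSystem (BCoxeterMatrix n) W)

theorem length_tau_inv_mul_tau_le {a b : ℕ} (hab : a ≤ b) :
    cs.length ((tau cs a)⁻¹ * tau cs b) ≤ b - a := by
  induction b, hab using Nat.le_induction with
  | base => simp
  | succ b hab ih =>
    have hs : cs.length (sgen cs b) ≤ 1 := by
      unfold sgen
      split_ifs <;> simp
    have h := cs.length_mul_le ((tau cs a)⁻¹ * tau cs b) (sgen cs b)
    have e : tau cs (b + 1) = tau cs b * sgen cs b := rangeProd_succ _ _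
    rw [mul_assoc, ← e] at h
    omega

theorem length_tau_le (k : ℕ) : cs.length (tau cs k) ≤ k := by
  simpa [tau_eq_rangeProd, rangeProd_zero] using length_tau_inv_mul_tau_le cs (Nat.zero_le k)

theorem length_tau_pow_le (k r : ℕ) : cs.length (tau cs k ^ r) ≤ r * k := by
  induction r with
  | zero => simp
  | succ r ih =>
    have h := cs.length_mul_le (tau cs k ^ r) (tau cs k)
    have h' := length_tau_le cs k
    rw [pow_succ, Nat.succ_mul]
    omega

/-- The subgroup generated by `s_0, …, s_{k-1}`. -/
def initialParabolic (k : ℕ) : Subgroup W :=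
  Subgroup.closure (cs.simple '' {i : Fin n | (i : ℕ) < k})

theorem initialParabolic_mono {k l : ℕ} (hkl : k ≤ l) :
    initialParabolic cs k ≤ initialParabolic cs l :=
  Subgroup.closure_mono (Set.image_mono fun _ hi ↦ lt_of_lt_of_le hi hkl)

theorem sgen_mem_initialParabolic {j k : ℕ} (hjk : j < k) : sgen cs j ∈ initialParabolic cs k := by
  unfold sgen
  split_ifs with hj
  · exact Subgroup.subset_closure ⟨⟨j, hj⟩, hjk, rfl⟩
  · exact one_mem _

theorem tau_mem_initialParabolic (k : ℕ) : tau cs k ∈ initialParabolic cs k := by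
  refine Subgroup.list_prod_mem _ fun x hx ↦ ?_
  obtain ⟨j, hj, rfl⟩ := List.mem_map.1 hx
  exact sgen_mem_initialParabolic cs (List.mem_range.1 hj)

theorem commute_tau_pow_self {p : ℕ} (hp : p ≤ n) {w : W} (hw : w ∈ initialParabolic cs p) :
    Commute (tau cs p ^ p) w := by
  induction hw using Subgroup.closure_induction with
  | mem x hx =>
    obtain ⟨i, hi, rfl⟩ := hx
    have h := ((isBraidB_sgen cs).mono hp).rangeProd_pow_commute hi
    rwa [← tau_eq_rangeProd, sgen_of_lt cs i.2] at h
  | one => exact Commute.one_right _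
  | mul x y _ _ hx hy => exact hx.mul_right hy
  | inv x _ hx => exact hx.inv_right

theorem isLeftDescent_tau_pow_self {p : ℕ} (hp : p ≤ n) {i : Fin n} (hi : (i : ℕ) < p) :
    cs.IsLeftDescent (tau cs p ^ p) i := by
  obtain ⟨q, rfl⟩ : ∃ q, p = q + 1 := ⟨p - 1, by omega⟩
  set v := tau cs (q + 1) ^ (q + 1) with hv
  have hc : Commute v (tau cs i) :=
    commute_tau_pow_self cs hp (initialParabolic_mono cs hi.le (tau_mem_initialParabolic cs i))
  have e : cs.simple i * v =
      ((tau cs (i + 1))⁻¹ * tau cs (q + 1)) * tau cs (q + 1) ^ q * tau cs i := by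
    have hs : (tau cs (i + 1))⁻¹ = cs.simple i * (tau cs i)⁻¹ := by
      rw [tau_eq_rangeProd, rangeProd_succ, mul_inv_rev, sgen_of_lt cs i.2, cs.inv_simple,
        tau_eq_rangeProd]
    rw [hs, mul_assoc _ (tau cs (q + 1)), ← pow_succ', ← hv, mul_assoc, hc.eq]
    group
  have h0 := sq_le_length_tau_pow_self cs hp
  have h1 := length_tau_inv_mul_tau_le cs (show (i : ℕ) + 1 ≤ q + 1 from hi)
  have h2 := length_tau_pow_le cs (q + 1) q
  have h3 := length_tau_le cs i
  have h4 := cs.length_mul_le ((tau cs (i + 1))⁻¹ * tau cs (q + 1)) (tau cs (q + 1) ^ q)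
  have h5 := cs.length_mul_le (((tau cs (i + 1))⁻¹ * tau cs (q + 1)) * tau cs (q + 1) ^ q)
    (tau cs i)
  rw [CoxeterSystem.IsLeftDescent, e]
  rw [← hv, Nat.succ_mul] at h0
  omega

theorem isLeftDescent_mul_tau_pow_self_iff {p : ℕ} (hp : p ≤ n) {u : W}
    (hu : u ∈ initialParabolic cs p) {i : Fin n} (hi : (i : ℕ) < p) :
    cs.IsLeftDescent (u * tau cs p ^ p) i ↔ ¬ cs.IsLeftDescent u i := by
  have hcu := (commute_tau_pow_self cs hp hu).inv_left
  have hci := (commute_tau_pow_self cs hp (Subgroup.subset_closure ⟨i, hi, rfl⟩)).inv_left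
  have hv := (cs.isLeftDescent_iff_inversionParity _ i).1 (isLeftDescent_tau_pow_self cs hp hi)
  rw [cs.isLeftDescent_iff_inversionParity, cs.isLeftDescent_iff_inversionParity, mul_inv_rev,
    cs.inversionParity_mul, cs.inversionParity_conj hcu.inv_right hci, hv]
  generalize cs.inversionParity u⁻¹ (cs.simple i) = x
  revert x
  decide

theorem signedAction_of_mem_initialParabolic {k : ℕ} {w : W} (hw : w ∈ initialParabolic cs k)
    {x : ℤ} (hk : 1 ≤ k) (hx : k < x) : signedAction cs w x = x := by
  induction hw using Subgroup.closure_induction with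
  | mem w hw =>
    obtain ⟨i, hi, rfl⟩ := hw
    rw [signedAction_simple]
    rw [Set.mem_ofPred_eq] at hi
    unfold signedSwap
    grind
  | one => exact signedAction_one_apply cs x
  | mul v w _ _ hv hw => rw [signedAction_mul_apply, hw, hv]
  | inv w _ hw =>
    have h := signedAction_mul_apply cs w⁻¹ w x
    rwa [inv_mul_cancel, signedAction_one_apply, hw, eq_comm] at h

theorem not_isLeftDescent_of_mem_initialParabolic {k : ℕ} (hk : 1 ≤ k) {u : W}
    (hu : u ∈ initialParabolic cs k) {i : Fin n} (hi : k ≤ (i : ℕ)) : ¬ cs.IsLeftDescent u i := by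
  intro h
  rw [cs.isLeftDescent_iff_inversionParity] at h
  have hmem : cs.simple i ∈ initialParabolic cs k :=
    cs.mem_closure_of_inversionParity_ne_zero (inv_mem hu) (by rw [h]; decide)
  have hfix := signedAction_of_mem_initialParabolic cs hmem (x := (i : ℕ) + 1) hk (by omega)
  rw [signedAction_simple] at hfix
  unfold signedSwap at hfix
  grind

end Descents

/-- Descents of `u·v` for `u` with an `Ṡ_n`-admissible presentation and
`v = τ_p^p` with `k_m ≤ p ≤ n`: for `j < k_m`, `j ∈ des(u·v) ↔ j ∉ des(u)`;
and every `j` with `k_m ≤ j < p` belongs to `des(u·v)`. -/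
theorem descents_u_mul_v (cs : CoxeterSystem (BCoxeterMatrix n) W)
    (u : W) (m : ℕ) (k : Fin m → ℕ) (i : Fin m → ℤ)
    (h : IsAdmissible cs u m k i) (hm : 0 < m)
    (p : ℕ) (hkp : k ⟨m - 1, Nat.sub_lt hm Nat.one_pos⟩ ≤ p) (hpn : p ≤ n) :
    (∀ j : ℕ, j < k ⟨m - 1, Nat.sub_lt hm Nat.one_pos⟩ →
      (IsDescentAt cs (u * tau cs p ^ p) j ↔ ¬ IsDescentAt cs u j)) ∧
    (∀ j : ℕ, k ⟨m - 1, Nat.sub_lt hm Nat.one_pos⟩ ≤ j → j < p →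
      IsDescentAt cs (u * tau cs p ^ p) j) := by
  set l : Fin m := ⟨m - 1, Nat.sub_lt hm Nat.one_pos⟩ with hl
  have hu : u ∈ initialParabolic cs (k l) := by
    rw [h.prod_eq]
    refine Subgroup.list_prod_mem _ fun x hx ↦ ?_
    obtain ⟨j, -, rfl⟩ := List.mem_map.1 hx
    have hj : j ≤ l := Fin.le_def.2 (Nat.le_sub_one_of_lt j.2)
    exact zpow_mem (initialParabolic_mono cs (h.mono.monotone hj)
      (tau_mem_initialParabolic cs (k j))) _
  have key {j : ℕ} (hj : j < p) :
      IsDescentAt cs (u * tau cs p ^ p) j ↔ ¬ IsDescentAt cs u j := by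
    have hjn : j < n := hj.trans_le hpn
    simp only [IsDescentAt, hjn, exists_true_left]
    exact isLeftDescent_mul_tau_pow_self_iff cs hpn (initialParabolic_mono cs hkp hu) hj
  refine ⟨fun j hj ↦ key (hj.trans_le hkp), fun j hkj hj ↦ (key hj).2 ?_⟩
  rintro ⟨_, hd⟩
  exact not_isLeftDescent_of_mem_initialParabolic cs (h.one_le l) hu hkj hd
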